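/- Multiplicative perturbation estimate under Mandel-tensor control: let c₂ > 0 and let W : M₃(ℝ) → [0, ∞) be continuously differentiable on the open set GL₊(3) = {A ∈ M₃(ℝ) : det A > 0}, with gradient matrix DW(A) (the matrix representing the Fréchet derivative of W at A with respect to the Frobenius inner product), satisfying ‖Aᵀ DW(A)‖_F ≤ c₂ (W(A) + 1) for all A ∈ GL₊(3). Then there exist constants c₃ > 0 and ε > 0 such that for all F, H ∈ GL₊(3) with ‖H − Id‖_F ≤ ε, one has |W(FH) − W(F)| ≤ c₃ (W(F) + 1) ‖H − Id‖_F. -/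

import Mathlib

open Matrix

attribute [local instance] Matrix.frobeniusNormedAddCommGroup Matrix.frobeniusNormedSpace
  Matrix.frobeniusNormedRing Matrix.frobeniusNormedAlgebra

theorem Matrix.abs_trace_transpose_mul_le {m n : Type*} [Fintype m] [Fintype n]
    (X Y : Matrix m n ℝ) : |(Xᵀ * Y).trace| ≤ ‖X‖ * ‖Y‖ := by
  have hnorm : ∀ Z : Matrix m n ℝ, ‖Z‖ = √(∑ i, ∑ j, Z i j ^ 2) := fun Z => by
    simp [Matrix.frobenius_norm_def, Real.sqrt_eq_rpow]
  have htrace : (Xᵀ * Y).trace = ∑ p : m × n, X p.1 p.2 * Y p.1 p.2 := by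
    rw [Fintype.sum_prod_type_right]
    simp [Matrix.trace, Matrix.mul_apply]
  rw [hnorm, hnorm, htrace, ← Fintype.sum_prod_type', ← Fintype.sum_prod_type',
    ← Real.sqrt_mul (Finset.sum_nonneg fun _ _ => sq_nonneg _), ← Real.sqrt_sq_eq_abs]
  exact Real.sqrt_le_sqrt (Finset.sum_mul_sq_le_sq_mul_sq _ _ _)

theorem Matrix.det_one_add_ne_zero_of_norm_lt_one {n : Type*} [Fintype n] [DecidableEq n]
    {X : Matrix n n ℝ} (hX : ‖X‖ < 1) : (1 + X).det ≠ 0 := by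
  have : CompleteSpace (Matrix n n ℝ) := FiniteDimensional.complete ℝ _
  have h : IsUnit (1 - -X) := isUnit_one_sub_of_norm_lt_one (by rwa [norm_neg])
  rw [sub_neg_eq_add, Matrix.isUnit_iff_isUnit_det] at h
  exact h.ne_zero

theorem Matrix.det_one_add_pos_of_norm_lt_one {n : Type*} [Fintype n] [DecidableEq n]
    {X : Matrix n n ℝ} (hX : ‖X‖ < 1) : 0 < (1 + X).det := by
  by_contra! hdet
  have hcont : Continuous fun t : ℝ => (1 + t • X).det :=
    (continuous_const.add (continuous_id.smul continuous_const)).matrix_det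
  obtain ⟨t, ht, h0⟩ := intermediate_value_Icc' (zero_le_one' ℝ) hcont.continuousOn
    (show (0 : ℝ) ∈ Set.Icc _ _ by simpa using hdet)
  refine Matrix.det_one_add_ne_zero_of_norm_lt_one (X := t • X) ?_ h0
  rw [norm_smul, Real.norm_of_nonneg ht.1]
  exact (mul_le_of_le_one_left (norm_nonneg _) ht.2).trans_lt hX

theorem Matrix.norm_nonsing_inv_one_add_mul_le {n : Type*} [Fintype n] [DecidableEq n]
    {X : Matrix n n ℝ} (hX : ‖X‖ ≤ 1 / 2) (Y : Matrix n n ℝ) :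
    ‖(1 + X)⁻¹ * Y‖ ≤ 2 * ‖Y‖ := by
  have hdet := Matrix.det_one_add_ne_zero_of_norm_lt_one (X := X) (by linarith)
  have h : (1 + X) * ((1 + X)⁻¹ * Y) = Y :=
    Matrix.mul_nonsing_inv_cancel_left _ _ hdet.isUnit
  set Z := (1 + X)⁻¹ * Y
  have hZ : Z = Y - X * Z := by
    rw [eq_sub_iff_add_eq, ← h, add_mul, one_mul]
  have h₁ : ‖Z‖ ≤ ‖Y‖ + ‖X * Z‖ := by
    conv_lhs => rw [hZ]
    exact norm_sub_le _ _
  have h₂ : ‖X * Z‖ ≤ 1 / 2 * ‖Z‖ :=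
    (norm_mul_le _ _).trans (mul_le_mul_of_nonneg_right hX (norm_nonneg _))
  linarith

/-- **Multiplicative perturbation estimate under Mandel-tensor control.** Let
`W : M₃(ℝ) → [0,∞)` be continuously differentiable on `GL₊(3) = {det > 0}` with gradient
matrix `DW A` (so that the Fréchet derivative of `W` at `A` is `B ↦ tr ((DW A)ᵀ B)`,
i.e. the Frobenius inner product against `DW A`), and assume the Mandel-tensor control
`‖Aᵀ * DW A‖_F ≤ c₂ (W A + 1)` on `GL₊(3)`. Then there are `c₃ > 0` and `ε > 0` such that
`|W (F * H) − W F| ≤ c₃ (W F + 1) ‖H − Id‖_F` whenever `F, H ∈ GL₊(3)` and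
`‖H − Id‖_F ≤ ε`. -/
theorem mandel_control_multiplicative_perturbation
    (c₂ : ℝ) (hc₂ : 0 < c₂)
    (W : Matrix (Fin 3) (Fin 3) ℝ → ℝ) (hW_nonneg : ∀ A, 0 ≤ W A)
    (DW : Matrix (Fin 3) (Fin 3) ℝ → Matrix (Fin 3) (Fin 3) ℝ)
    (hW_diff : ∀ A : Matrix (Fin 3) (Fin 3) ℝ, 0 < A.det →
      HasFDerivAt W (LinearMap.toContinuousLinearMap
        ((Matrix.traceLinearMap (Fin 3) ℝ ℝ).comp (LinearMap.mulLeft ℝ (DW A)ᵀ))) A)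
    (hDW_cont : ContinuousOn DW {A : Matrix (Fin 3) (Fin 3) ℝ | 0 < A.det})
    (hMandel : ∀ A : Matrix (Fin 3) (Fin 3) ℝ, 0 < A.det →
      ‖Aᵀ * DW A‖ ≤ c₂ * (W A + 1)) :
    ∃ c₃ > (0 : ℝ), ∃ ε > (0 : ℝ), ∀ F H : Matrix (Fin 3) (Fin 3) ℝ,
      0 < F.det → 0 < H.det → ‖H - 1‖ ≤ ε →
      |W (F * H) - W F| ≤ c₃ * (W F + 1) * ‖H - 1‖ := by
  refine ⟨4 * c₂, by positivity, min (1 / 2) (1 / (2 * c₂)), by positivity, ?_⟩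
  intro F H hF _ hε
  obtain ⟨K, rfl⟩ : ∃ K, H = 1 + K := ⟨H - 1, by abel⟩
  rw [add_sub_cancel_left] at hε ⊢
  have hK : ‖K‖ ≤ 1 / 2 := hε.trans (min_le_left _ _)
  rcases eq_or_ne K 0 with rfl | hK0
  · simp
  set L := 2 * c₂ * ‖K‖ with hL
  have hLpos : 0 < L := by positivity
  have hL1 : L ≤ 1 := by
    have h := hε.trans (min_le_right _ _)
    rw [le_div_iff₀ (by positivity)] at h
    linarith
  have htK : ∀ t ∈ Set.Icc (0 : ℝ) 1, ‖t • K‖ ≤ 1 / 2 := fun t ht => by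
    rw [norm_smul, Real.norm_of_nonneg ht.1]
    exact (mul_le_of_le_one_left (norm_nonneg _) ht.2).trans hK
  have hdet : ∀ t ∈ Set.Icc (0 : ℝ) 1, 0 < (F * (1 + t • K)).det := fun t ht => by
    rw [Matrix.det_mul]
    exact mul_pos hF (Matrix.det_one_add_pos_of_norm_lt_one (by linarith [htK t ht]))
  have hderiv : ∀ t ∈ Set.Icc (0 : ℝ) 1, HasDerivAt (fun s : ℝ => W (F * (1 + s • K)) - W F)
      ((DW (F * (1 + t • K)))ᵀ * (F * K)).trace t := fun t ht => by
    have hline : HasDerivAt (fun s : ℝ => F * (1 + s • K)) (F * K) t := by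
      have h := ((hasDerivAt_id t).smul_const (F * K)).const_add F
      simp only [id_eq, one_smul] at h
      simp only [mul_add, mul_one, mul_smul_comm]
      exact h
    exact ((hW_diff _ (hdet t ht)).comp_hasDerivAt t hline).sub_const (W F)
  have hbound : ∀ t ∈ Set.Ico (0 : ℝ) 1, ‖((DW (F * (1 + t • K)))ᵀ * (F * K)).trace‖ ≤
      L * ‖W (F * (1 + t • K)) - W F‖ + L * (W F + 1) := fun t ht => by
    have ht' := Set.Ico_subset_Icc_self ht
    have hunit : IsUnit (1 + t • K).det :=
      (Matrix.det_one_add_ne_zero_of_norm_lt_one (by linarith [htK t ht'])).isUnit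
    have heq : (DW (F * (1 + t • K)))ᵀ * (F * K) =
        ((F * (1 + t • K))ᵀ * DW (F * (1 + t • K)))ᵀ * ((1 + t • K)⁻¹ * K) := by
      rw [Matrix.transpose_mul _ (DW _), Matrix.transpose_transpose, Matrix.mul_assoc,
        Matrix.mul_assoc F, Matrix.mul_nonsing_inv_cancel_left _ _ hunit]
    have hM := hMandel _ (hdet t ht')
    have hW := le_abs_self (W (F * (1 + t • K)) - W F)
    rw [heq, Real.norm_eq_abs, Real.norm_eq_abs]
    calc _ ≤ ‖(F * (1 + t • K))ᵀ * DW (F * (1 + t • K))‖ * ‖(1 + t • K)⁻¹ * K‖ :=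
          Matrix.abs_trace_transpose_mul_le _ _
      _ ≤ (c₂ * (W (F * (1 + t • K)) + 1)) * (2 * ‖K‖) :=
          mul_le_mul hM (Matrix.norm_nonsing_inv_one_add_mul_le (htK t ht') K) (norm_nonneg _)
            ((norm_nonneg _).trans hM)
      _ = L * (W (F * (1 + t • K)) - W F) + L * (W F + 1) := by rw [hL]; ring
      _ ≤ _ := by gcongr
  have hgronwall := norm_le_gronwallBound_of_norm_deriv_right_le (δ := 0)
    (fun t ht => (hderiv t ht).continuousAt.continuousWithinAt)
    (fun t ht => (hderiv t (Set.Ico_subset_Icc_self ht)).hasDerivWithinAt)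
    (by simp) hbound 1 (Set.right_mem_Icc.2 zero_le_one)
  rw [gronwallBound_of_K_ne_0 hLpos.ne', Real.norm_eq_abs, one_smul] at hgronwall
  simp only [zero_mul, zero_add] at hgronwall
  rw [mul_div_cancel_left₀ _ hLpos.ne', sub_zero, mul_one] at hgronwall
  have hexp : Real.exp L - 1 ≤ 2 * L := by
    have h := Real.abs_exp_sub_one_le (x := L) (by rwa [abs_of_pos hLpos])
    rw [abs_of_pos hLpos] at h
    exact (le_abs_self _).trans h
  calc _ ≤ (W F + 1) * (Real.exp L - 1) := hgronwall
    _ ≤ (W F + 1) * (2 * L) :=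
      mul_le_mul_of_nonneg_left hexp (by linarith [hW_nonneg F])
    _ = 4 * c₂ * (W F + 1) * ‖K‖ := by rw [hL]; ring
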